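/- Let B be a d×d real symmetric positive definite matrix with condition number κ(B) = λ_max(B)/λ_min(B), and let v ∈ ℝ^d satisfy vᵀ B v = 1. If w is drawn uniformly at random from the unit sphere in ℝ^d, then for every ζ ∈ (0,1), with probability at least 1 − ζ one has cos θ_B(w, v) ≥ ζ / √(d · κ(B)), where cos θ_B(w, v) = |wᵀ B v| / √(wᵀ B w). -/

import Mathlib

open Matrix MeasureTheory

/-- Householder reflection exchanging two vectors of the same length. -/
lemma exists_orth {d : ℕ} (e f : Fin d → ℝ) (h : e ⬝ᵥ e = f ⬝ᵥ f) :
    ∃ R : Matrix (Fin d) (Fin d) ℝ, R ∈ Matrix.orthogonalGroup (Fin d) ℝ ∧ Rᵀ *ᵥ f = e := by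
  by_cases hef : e = f
  · exact ⟨1, one_mem _, by simp [hef]⟩
  set x := e - f with hx
  have hx0 : x ⬝ᵥ x ≠ 0 := by
    rw [Ne, dotProduct_self_eq_zero]
    exact sub_ne_zero.mpr hef
  set c := 2 / (x ⬝ᵥ x) with hc
  have hcx : c * (x ⬝ᵥ x) = 2 := by rw [hc]; field_simp
  have hT : (1 - c • vecMulVec x x)ᵀ = 1 - c • vecMulVec x x := by
    simp [transpose_sub, transpose_smul, transpose_vecMulVec]
  refine ⟨1 - c • vecMulVec x x, ?_, ?_⟩
  · rw [mem_orthogonalGroup_iff]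
    change (1 - c • vecMulVec x x) * (1 - c • vecMulVec x x)ᵀ = 1
    rw [hT]
    rw [sub_mul, mul_sub, mul_sub]
    simp only [one_mul, mul_one, smul_mul_smul_comm, vecMulVec_mul_vecMulVec]
    ext i j
    simp only [Matrix.sub_apply, Matrix.smul_apply, vecMulVec_apply, smul_eq_mul, Pi.smul_apply]
    linear_combination (c * x i * x j) * hcx
  · rw [hT, sub_mulVec, smul_mulVec, vecMulVec_mulVec, one_mulVec]
    have h2 : c * (x ⬝ᵥ f) = -1 := by
      have : x ⬝ᵥ x = - 2 * (x ⬝ᵥ f) := by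
        simp only [hx, sub_dotProduct, dotProduct_sub]
        rw [h, dotProduct_comm f e]; ring
      rw [this] at hcx; linarith
    ext i
    simp only [Pi.sub_apply, Pi.smul_apply, smul_eq_mul, MulOpposite.smul_eq_mul_unop,
      MulOpposite.unop_op]
    have : x i = e i - f i := rfl
    linear_combination (-x i) * h2 + this

def capSet {d : ℕ} (t : ℝ) (e : Fin d → ℝ) : Set (Fin d → ℝ) :=
  {w | |w ⬝ᵥ e| < t * (√(w ⬝ᵥ w) * √(e ⬝ᵥ e))}

lemma meas_cap {d : ℕ} (t : ℝ) (e : Fin d → ℝ) : MeasurableSet (capSet t e) := by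
  unfold capSet dotProduct
  exact measurableSet_lt (by fun_prop) (by fun_prop)

lemma cap_smul {d : ℕ} (t : ℝ) (e : Fin d → ℝ) (c : ℝ) (hc : 0 < c) :
    capSet t (c • e) = capSet t e := by
  ext w
  simp only [capSet, Set.mem_ofPred_eq, dotProduct_smul, smul_dotProduct, smul_eq_mul]
  rw [abs_mul, abs_of_pos hc, ← mul_assoc c c, Real.sqrt_mul (by positivity),
    Real.sqrt_mul_self hc.le]
  rw [show t * (√(w ⬝ᵥ w) * (c * √(e ⬝ᵥ e))) = c * (t * (√(w ⬝ᵥ w) * √(e ⬝ᵥ e))) by ring]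
  exact mul_lt_mul_iff_right₀ hc

lemma cap_inv {d : ℕ} (μ : Measure (Fin d → ℝ))
    (hinv : ∀ R : Matrix (Fin d) (Fin d) ℝ, R ∈ Matrix.orthogonalGroup (Fin d) ℝ →
      Measure.map (fun w => R.mulVec w) μ = μ) (t : ℝ) (e f : Fin d → ℝ)
      (he : e ≠ 0) (hf : f ≠ 0) : μ (capSet t e) = μ (capSet t f) := by
  have pos : ∀ g : Fin d → ℝ, g ≠ 0 → 0 < g ⬝ᵥ g := fun g hg => by
    have := (dotProduct_star_self_pos_iff (v := g)).2 hg
    simpa using this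
  have he' := Real.sqrt_pos.2 (pos e he)
  have hf' := Real.sqrt_pos.2 (pos f hf)
  rw [← cap_smul t f (√(e ⬝ᵥ e) / √(f ⬝ᵥ f)) (by positivity)]
  set f' := (√(e ⬝ᵥ e) / √(f ⬝ᵥ f)) • f with hf'def
  have hee : e ⬝ᵥ e = f' ⬝ᵥ f' := by
    simp only [hf'def, dotProduct_smul, smul_dotProduct, smul_eq_mul]
    have h1 := Real.mul_self_sqrt (pos e he).le
    have h2 := Real.mul_self_sqrt (pos f hf).le
    have h3 : √(e ⬝ᵥ e) / √(f ⬝ᵥ f) * √(f ⬝ᵥ f) = √(e ⬝ᵥ e) := by field_simp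
    generalize √(e ⬝ᵥ e) / √(f ⬝ᵥ f) = r at h3 ⊢
    rw [← h2, ← h1, ← h3]; ring
  obtain ⟨R, hR, hRe⟩ := exists_orth e f' hee
  conv_rhs => rw [← hinv R hR]
  rw [Measure.map_apply (by unfold mulVec dotProduct; fun_prop) (meas_cap _ _)]
  congr 1
  ext w
  have hRR : Rᵀ * R = 1 := by
    simpa [star_eq_conjTranspose] using (mem_orthogonalGroup_iff' (Fin d) ℝ).1 hR
  have h1 : (R *ᵥ w) ⬝ᵥ f' = w ⬝ᵥ e := by
    rw [← hRe, dotProduct_mulVec, vecMul_transpose]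
  have h2 : (R *ᵥ w) ⬝ᵥ (R *ᵥ w) = w ⬝ᵥ w := by
    rw [dotProduct_mulVec, vecMul_mulVec, hRR, vecMul_one]
  simp only [capSet, Set.mem_ofPred_eq, Set.mem_preimage, h1, h2, hee]

open ProbabilityTheory

lemma gauss_inv {d : ℕ} (R : Matrix (Fin d) (Fin d) ℝ) (hR : R ∈ Matrix.orthogonalGroup (Fin d) ℝ) :
    Measure.map (fun w => R.mulVec w) (Measure.pi (fun _ : Fin d => gaussianReal 0 1))
      = Measure.pi (fun _ : Fin d => gaussianReal 0 1) := by
  have hRR : Rᵀ * R = 1 := by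
    simpa [star_eq_conjTranspose] using (mem_orthogonalGroup_iff' (Fin d) ℝ).1 hR
  let L : EuclideanSpace ℝ (Fin d) →ₗᵢ[ℝ] EuclideanSpace ℝ (Fin d) :=
    { toLinearMap := Matrix.toEuclideanLin R
      norm_map' := fun x => by
        rw [← sq_eq_sq₀ (norm_nonneg _) (norm_nonneg _), EuclideanSpace.real_norm_sq_eq,
          EuclideanSpace.real_norm_sq_eq]
        have h2 : (R *ᵥ x.ofLp) ⬝ᵥ (R *ᵥ x.ofLp) = x.ofLp ⬝ᵥ x.ofLp := by
          rw [dotProduct_mulVec, vecMul_mulVec, hRR, vecMul_one]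
        simpa [dotProduct, sq] using h2 }
  have h := stdGaussian_map (L.toLinearIsometryEquiv rfl)
  rw [← map_pi_eq_stdGaussian, Measure.map_map (by fun_prop) (by fun_prop)] at h
  have h3 := congrArg (Measure.map (WithLp.ofLp)) h
  rw [Measure.map_map (by fun_prop) (by fun_prop), Measure.map_map (by fun_prop) (by fun_prop)] at h3
  convert h3 using 1
  · rfl
  · exact Measure.map_id.symm

lemma gauss_le (s : ℝ) : gaussianReal 0 1 {x | |x| < s} ≤ ENNReal.ofReal s := by
  rw [gaussianReal_apply 0 one_ne_zero]
  calc ∫⁻ x in {x : ℝ | |x| < s}, gaussianPDF 0 1 x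
      ≤ ∫⁻ x in {x : ℝ | |x| < s}, ENNReal.ofReal (1/2) := by
        apply lintegral_mono
        intro x
        apply ENNReal.ofReal_le_ofReal
        rw [gaussianPDFReal]
        have h1 : Real.exp (-(x - 0) ^ 2 / (2 * ((1 : NNReal) : ℝ))) ≤ 1 := by
          rw [Real.exp_le_one_iff]
          have := sq_nonneg (x - 0)
          simp only [NNReal.coe_one]; linarith
        have h2 : (√(2 * Real.pi * ((1 : NNReal) : ℝ)))⁻¹ ≤ 1/2 := by
          rw [inv_eq_one_div]
          apply one_div_le_one_div_of_le (by norm_num)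
          apply Real.le_sqrt_of_sq_le
          have := Real.pi_gt_three
          simp only [NNReal.coe_one]; linarith
        have h3 := Real.exp_nonneg (-(x - 0) ^ 2 / (2 * ((1 : NNReal) : ℝ)))
        nlinarith
    _ = ENNReal.ofReal s := by
        have : {x : ℝ | |x| < s} = Set.Ioo (-s) s := by ext x; simp [abs_lt]
        rw [setLIntegral_const, this, Real.volume_Ioo, ← ENNReal.ofReal_mul (by norm_num)]
        congr 1; ring

lemma gauss_sq : ∫⁻ x, ENNReal.ofReal (x ^ 2) ∂(gaussianReal 0 1) = 1 := by
  have hm : MemLp id 2 (gaussianReal 0 1) := memLp_id_gaussianReal 2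
  rw [← ofReal_integral_eq_lintegral_ofReal (f := fun x : ℝ => x ^ 2) hm.integrable_sq
    (Filter.Eventually.of_forall fun x => sq_nonneg _)]
  have := variance_fun_id_gaussianReal (μ := 0) (v := 1)
  rw [variance_eq_integral (by fun_prop)] at this
  simp only [integral_id_gaussianReal, sub_zero] at this
  rw [this]; simp

lemma gauss_sum (n : ℕ) : ∫⁻ x, ENNReal.ofReal (x ⬝ᵥ x)
    ∂(Measure.pi (fun _ : Fin n => gaussianReal 0 1)) = n := by
  have : ∀ x : Fin n → ℝ, ENNReal.ofReal (x ⬝ᵥ x) = ∑ i, ENNReal.ofReal (x i ^ 2) := fun x => by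
    rw [← ENNReal.ofReal_sum_of_nonneg (fun i _ => sq_nonneg _)]; simp [dotProduct, sq]
  simp_rw [this]
  rw [lintegral_finsetSum _ (fun i _ => by fun_prop)]
  have : ∀ i : Fin n, ∫⁻ x, ENNReal.ofReal (x i ^ 2)
      ∂(Measure.pi (fun _ : Fin n => gaussianReal 0 1)) = 1 := fun i => by
    rw [← gauss_sq]
    exact (measurePreserving_eval (fun _ : Fin n => gaussianReal 0 1) i).lintegral_comp
      (f := fun x => ENNReal.ofReal (x^2)) (by fun_prop)
  simp [this]

lemma gauss_sqrt (n : ℕ) : ∫⁻ x, ENNReal.ofReal (√(x ⬝ᵥ x))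
    ∂(Measure.pi (fun _ : Fin n => gaussianReal 0 1)) ≤ ENNReal.ofReal (√n) := by
  rcases Nat.eq_zero_or_pos n with rfl | hn
  · simp [dotProduct]
  have hn' : (0:ℝ) < n := by exact_mod_cast hn
  have hs := Real.sqrt_pos.2 hn'
  calc _ ≤ ∫⁻ x, (ENNReal.ofReal (1 / (2 * √n)) * ENNReal.ofReal (x ⬝ᵥ x) + ENNReal.ofReal (√n / 2))
        ∂(Measure.pi (fun _ : Fin n => gaussianReal 0 1)) := by
        apply lintegral_mono
        intro x
        have hx : 0 ≤ x ⬝ᵥ x := by simpa using dotProduct_star_self_nonneg x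
        dsimp only
        rw [← ENNReal.ofReal_mul (by positivity), ← ENNReal.ofReal_add (by positivity) (by positivity)]
        apply ENNReal.ofReal_le_ofReal
        have h1 := Real.sq_sqrt hx
        have h2 := Real.sq_sqrt hn'.le
        have h3 := sq_nonneg (√(x ⬝ᵥ x) - √n)
        rw [← sub_nonneg]
        have : 1 / (2 * √n) * (x ⬝ᵥ x) + √n / 2 - √(x ⬝ᵥ x)
          = (√(x ⬝ᵥ x) - √n)^2 / (2 * √n) := by
          conv_lhs => rw [← h1]
          rw [Real.sqrt_sq (Real.sqrt_nonneg _)]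
          field_simp; ring
        rw [this]; positivity
    _ = ENNReal.ofReal (√n) := by
        rw [lintegral_add_right _ (by fun_prop), lintegral_const_mul _ (by unfold dotProduct; fun_prop), gauss_sum]
        simp only [lintegral_const, measure_univ, mul_one]
        rw [← ENNReal.ofReal_natCast, ← ENNReal.ofReal_mul (by positivity), ← ENNReal.ofReal_add (by positivity) (by positivity)]
        congr 1
        have h2 := Real.sq_sqrt hn'.le
        field_simp; linarith

lemma gauss_cap (n : ℕ) (ζ : ℝ) (h0 : 0 < ζ) (h1 : ζ < 1) :
    (Measure.pi (fun _ : Fin (n+1) => gaussianReal 0 1))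
      (capSet (ζ / √((n + 1 : ℕ) : ℝ)) (Pi.single 0 1)) ≤ ENNReal.ofReal ζ := by
  set c := ζ / √((n:ℝ) + 1 - ζ^2) with hc
  have hD : 0 < (n:ℝ) + 1 - ζ^2 := by
    have : (0:ℝ) ≤ n := Nat.cast_nonneg n
    nlinarith
  have hDs := Real.sqrt_pos.2 hD
  have hcpos : 0 < c := by positivity
  have mp := measurePreserving_piFinSuccAbove (fun _ : Fin (n+1) => gaussianReal 0 1) 0
  let S : Set (ℝ × (Fin n → ℝ)) := {p | |p.1| < c * √(p.2 ⬝ᵥ p.2)}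
  have hS : MeasurableSet S := by
    unfold S dotProduct
    exact measurableSet_lt (by fun_prop) (by fun_prop)
  calc _ ≤ (Measure.pi (fun _ : Fin (n+1) => gaussianReal 0 1))
        ((MeasurableEquiv.piFinSuccAbove (fun _ => ℝ) 0) ⁻¹' S) := by
        apply measure_mono
        intro w hw
        simp only [capSet, Set.mem_ofPred_eq, dotProduct_single, mul_one,
          Pi.single_eq_same, Real.sqrt_one] at hw
        change |w 0| < c * √((fun i : Fin n => w i.succ) ⬝ᵥ (fun i : Fin n => w i.succ))
        have hsplit : w ⬝ᵥ w = w 0 ^ 2 + (fun i : Fin n => w i.succ) ⬝ᵥ (fun i : Fin n => w i.succ) := by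
          simp [dotProduct, Fin.sum_univ_succ, sq]
        set q := (fun i : Fin n => w i.succ) ⬝ᵥ (fun i : Fin n => w i.succ)
        have hq : 0 ≤ q := by simpa using dotProduct_star_self_nonneg (fun i : Fin n => w i.succ)
        rw [hsplit] at hw
        have hN : (0:ℝ) < ((n+1 : ℕ) : ℝ) := by positivity
        apply abs_lt_of_sq_lt_sq _ (by positivity) |> abs_lt.1 |> abs_lt.2
        have hw2 := (sq_lt_sq₀ (abs_nonneg _) (by positivity)).2 hw
        rw [sq_abs, mul_pow, div_pow, Real.sq_sqrt hN.le, Real.sq_sqrt (by positivity)] at hw2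
        rw [mul_pow, hc, div_pow, Real.sq_sqrt hD.le, Real.sq_sqrt hq]
        rw [div_mul_eq_mul_div, lt_div_iff₀ hD]
        rw [div_mul_eq_mul_div, lt_div_iff₀ hN] at hw2
        push_cast at hw2
        nlinarith
    _ = ((gaussianReal 0 1).prod (Measure.pi fun _ : Fin n => gaussianReal 0 1)) S :=
        mp.measure_preimage hS.nullMeasurableSet
    _ = ∫⁻ y, gaussianReal 0 1 {x | |x| < c * √(y ⬝ᵥ y)} ∂(Measure.pi fun _ : Fin n => gaussianReal 0 1) := by
        rw [Measure.prod_apply_symm hS]; rfl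
    _ ≤ ∫⁻ y, ENNReal.ofReal c * ENNReal.ofReal (√(y ⬝ᵥ y)) ∂(Measure.pi fun _ : Fin n => gaussianReal 0 1) := by
        apply lintegral_mono
        intro y
        dsimp only
        rw [← ENNReal.ofReal_mul hcpos.le]
        exact gauss_le _
    _ ≤ ENNReal.ofReal c * ENNReal.ofReal (√n) := by
        rw [lintegral_const_mul _ (by unfold dotProduct; fun_prop)]
        gcongr
        exact gauss_sqrt n
    _ ≤ ENNReal.ofReal ζ := by
        rw [← ENNReal.ofReal_mul hcpos.le]
        apply ENNReal.ofReal_le_ofReal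
        rw [hc, div_mul_eq_mul_div, div_le_iff₀ hDs]
        gcongr
        nlinarith

lemma sphere_cap (n : ℕ) (ζ : ℝ) (h0 : 0 < ζ) (h1 : ζ < 1) (μ : Measure (Fin (n+1) → ℝ))
    [IsProbabilityMeasure μ]
    (hsphere : ∀ᵐ w ∂μ, ∑ i, (w i) ^ 2 = 1)
    (hinv : ∀ R : Matrix (Fin (n+1)) (Fin (n+1)) ℝ, R ∈ Matrix.orthogonalGroup (Fin (n+1)) ℝ →
      Measure.map (fun w => R.mulVec w) μ = μ) (u : Fin (n+1) → ℝ) (hu : u ≠ 0) :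
    μ (capSet (ζ / √((n + 1 : ℕ) : ℝ)) u) ≤ ENNReal.ofReal ζ := by
  set t := ζ / √((n + 1 : ℕ) : ℝ)
  set γ := Measure.pi (fun _ : Fin (n+1) => gaussianReal 0 1) with hγ
  let S : Set ((Fin (n+1) → ℝ) × (Fin (n+1) → ℝ)) :=
    {p | |p.1 ⬝ᵥ p.2| < t * (√(p.1 ⬝ᵥ p.1) * √(p.2 ⬝ᵥ p.2))}
  have hS : MeasurableSet S := by
    unfold S dotProduct
    exact measurableSet_lt (by fun_prop) (by fun_prop)
  have hne : ∀ᵐ g ∂γ, g ≠ 0 := by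
    have : NullSingletonClass (gaussianReal 0 1) := nullSingletonClass_gaussianReal one_ne_zero
    have : γ {g | g 0 = 0} = 0 := by
      have := (measurePreserving_eval (fun _ : Fin (n+1) => gaussianReal 0 1) 0).measure_preimage
        (measurableSet_singleton (0:ℝ)).nullMeasurableSet
      rw [measure_singleton] at this
      exact this
    rw [ae_iff]
    refine measure_mono_null (fun g hg => ?_) this
    simp only [ne_eq, not_not, Set.mem_ofPred_eq] at hg ⊢
    simp [hg]
  calc μ (capSet t u) = ∫⁻ g, μ (capSet t u) ∂γ := by simp
    _ = ∫⁻ g, μ ((fun w => (w, g)) ⁻¹' S) ∂γ := by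
        apply lintegral_congr_ae
        filter_upwards [hne] with g hg
        exact cap_inv μ hinv t u g hu hg
    _ = (μ.prod γ) S := (Measure.prod_apply_symm hS).symm
    _ = ∫⁻ w, γ (Prod.mk w ⁻¹' S) ∂μ := Measure.prod_apply hS
    _ ≤ ∫⁻ w, ENNReal.ofReal ζ ∂μ := by
        apply lintegral_mono_ae
        filter_upwards [hsphere] with w hw
        have hw0 : w ≠ 0 := by rintro rfl; simp at hw
        have : Prod.mk w ⁻¹' S = capSet t w := by
          ext g
          simp only [S, capSet, Set.mem_ofPred_eq, Set.mem_preimage]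
          rw [dotProduct_comm w g, mul_comm (√(w ⬝ᵥ w))]
        rw [this, cap_inv γ gauss_inv t w (Pi.single 0 1) hw0 (by simp)]
        exact gauss_cap n ζ h0 h1
    _ = ENNReal.ofReal ζ := by simp

lemma spec {d : ℕ} (B : Matrix (Fin d) (Fin d) ℝ) (hB : B.IsHermitian) (w : Fin d → ℝ) :
    ∃ c : Fin d → ℝ, w ⬝ᵥ w = ∑ i, c i ^ 2 ∧ w ⬝ᵥ B *ᵥ w = ∑ i, hB.eigenvalues i * c i ^ 2 ∧
      (B *ᵥ w) ⬝ᵥ (B *ᵥ w) = ∑ i, hB.eigenvalues i ^ 2 * c i ^ 2 := by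
  set U : Matrix (Fin d) (Fin d) ℝ := hB.eigenvectorUnitary.1 with hU
  have hUU : Uᵀ * U = 1 := by
    simpa [star_eq_conjTranspose] using (mem_orthogonalGroup_iff' (Fin d) ℝ).1 hB.eigenvectorUnitary.2
  have hUU' : U * Uᵀ = 1 := mul_eq_one_comm.1 hUU
  have hBU : B = U * diagonal hB.eigenvalues * Uᵀ := by
    have := hB.spectral_theorem
    rw [Unitary.conjStarAlgAut_apply] at this
    simpa [star_eq_conjTranspose, Function.comp_def] using this
  set c := Uᵀ *ᵥ w with hc
  have hw : w = U *ᵥ c := by rw [hc, mulVec_mulVec, hUU', one_mulVec]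
  have iso : ∀ a b : Fin d → ℝ, (U *ᵥ a) ⬝ᵥ (U *ᵥ b) = a ⬝ᵥ b := fun a b => by
    rw [dotProduct_mulVec, vecMul_mulVec, hUU, vecMul_one]
  have hBw : B *ᵥ w = U *ᵥ (diagonal hB.eigenvalues *ᵥ c) := by
    conv_lhs => rw [hBU]
    rw [hc, mulVec_mulVec, mulVec_mulVec, mul_assoc]
  refine ⟨c, ?_, ?_, ?_⟩
  · conv_lhs => rw [hw]
    rw [iso]; simp [dotProduct, sq]
  · rw [hBw]
    conv_lhs => rw [hw]
    rw [iso]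
    simp only [dotProduct, mulVec_diagonal]
    exact Finset.sum_congr rfl fun i _ => by ring
  · rw [hBw, iso]
    simp only [dotProduct, mulVec_diagonal]
    exact Finset.sum_congr rfl fun i _ => by ring

theorem random_init_cos_angle_lower_bound (d : ℕ)
    (B : Matrix (Fin d) (Fin d) ℝ) (hB : B.PosDef)
    (α β : ℝ)
    (hα : IsLeast (Set.range hB.1.eigenvalues) α)
    (hβ : IsGreatest (Set.range hB.1.eigenvalues) β)
    (κ : ℝ) (hκ : κ = β / α)
    (v : Fin d → ℝ) (hv : v ⬝ᵥ B.mulVec v = 1)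
    (μ : Measure (Fin d → ℝ)) [IsProbabilityMeasure μ]
    (hsphere : ∀ᵐ w ∂μ, ∑ i, (w i) ^ 2 = 1)
    (hinv : ∀ R : Matrix (Fin d) (Fin d) ℝ, R ∈ Matrix.orthogonalGroup (Fin d) ℝ →
      Measure.map (fun w => R.mulVec w) μ = μ) :
    ∀ ζ : ℝ, 0 < ζ → ζ < 1 →
      ENNReal.ofReal (1 - ζ) ≤
        μ {w : Fin d → ℝ |
            ζ / Real.sqrt (d * κ) ≤ |w ⬝ᵥ B.mulVec v| / Real.sqrt (w ⬝ᵥ B.mulVec w)} := by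
  intro ζ h0 h1
  obtain ⟨⟨i0, hi0⟩, hαl⟩ := hα
  have hαi : ∀ i, α ≤ hB.1.eigenvalues i := fun i => hαl ⟨i, rfl⟩
  have hβi : ∀ i, hB.1.eigenvalues i ≤ β := fun i => hβ.2 ⟨i, rfl⟩
  have hα0 : 0 < α := hi0 ▸ hB.eigenvalues_pos i0
  have hβ0 : 0 < β := hα0.trans_le ((hαi i0).trans (hβi i0))
  obtain ⟨n, rfl⟩ : ∃ n, d = n + 1 := ⟨d - 1, by have := i0.2; omega⟩
  set u := B *ᵥ v with hu
  have hu0 : u ≠ 0 := by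
    intro h; rw [h] at hv; simp at hv
  have huα : α ≤ u ⬝ᵥ u := by
    obtain ⟨c, -, h2, h3⟩ := spec B hB.1 v
    rw [hv] at h2
    rw [hu, h3]
    calc α = ∑ i, α * (hB.1.eigenvalues i * c i ^ 2) := by rw [← Finset.mul_sum, ← h2, mul_one]
      _ ≤ _ := by
        apply Finset.sum_le_sum
        intro i _
        have h4 := hαi i
        have h5 : 0 ≤ hB.1.eigenvalues i * c i ^ 2 := mul_nonneg (hα0.le.trans h4) (sq_nonneg _)
        nlinarith
  set G := {w : Fin (n+1) → ℝ |
            ζ / Real.sqrt ((n+1 : ℕ) * κ) ≤ |w ⬝ᵥ u| / Real.sqrt (w ⬝ᵥ B.mulVec w)} with hG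
  have hGc : μ Gᶜ ≤ ENNReal.ofReal ζ := by
    refine le_trans (measure_mono_ae ?_) (sphere_cap n ζ h0 h1 μ hsphere hinv u hu0)
    filter_upwards [hsphere] with w hw hwG
    have hww : w ⬝ᵥ w = 1 := by rw [← hw]; simp [dotProduct, sq]
    have hwB : α ≤ w ⬝ᵥ B *ᵥ w ∧ w ⬝ᵥ B *ᵥ w ≤ β := by
      obtain ⟨c, h2, h3, -⟩ := spec B hB.1 w
      rw [hww] at h2
      rw [h3]
      constructor
      · calc α = ∑ i, α * c i ^ 2 := by rw [← Finset.mul_sum, ← h2, mul_one]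
          _ ≤ _ := Finset.sum_le_sum fun i _ => mul_le_mul_of_nonneg_right (hαi i) (sq_nonneg _)
      · calc _ ≤ ∑ i, β * c i ^ 2 :=
              Finset.sum_le_sum fun i _ => mul_le_mul_of_nonneg_right (hβi i) (sq_nonneg _)
          _ = β := by rw [← Finset.mul_sum, ← h2, mul_one]
    have hwlt : |w ⬝ᵥ u| / √(w ⬝ᵥ B *ᵥ w) < ζ / √((n+1 : ℕ) * κ) := not_le.1 hwG
    have hs := Real.sqrt_pos.2 (hα0.trans_le hwB.1)
    rw [div_lt_iff₀ hs] at hwlt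
    change |w ⬝ᵥ u| < ζ / √((n + 1 : ℕ) : ℝ) * (√(w ⬝ᵥ w) * √(u ⬝ᵥ u))
    rw [hww, Real.sqrt_one, one_mul]
    refine hwlt.trans_le ?_
    have hb : √(w ⬝ᵥ B *ᵥ w) ≤ √β := Real.sqrt_le_sqrt hwB.2
    have ha : √α ≤ √(u ⬝ᵥ u) := Real.sqrt_le_sqrt huα
    have hsβ := Real.sqrt_pos.2 hβ0
    have hsα := Real.sqrt_pos.2 hα0
    have hN : (0:ℝ) < √((n + 1 : ℕ) : ℝ) := Real.sqrt_pos.2 (by positivity)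
    rw [hκ, Real.sqrt_mul (by positivity), Real.sqrt_div hβ0.le]
    calc ζ / (√((n + 1 : ℕ) : ℝ) * (√β / √α)) * √(w ⬝ᵥ B *ᵥ w)
        ≤ ζ / (√((n + 1 : ℕ) : ℝ) * (√β / √α)) * √β := by gcongr
      _ = ζ / √((n + 1 : ℕ) : ℝ) * √α := by field_simp
      _ ≤ _ := by gcongr
  rw [ENNReal.ofReal_sub _ h0.le, ENNReal.ofReal_one, tsub_le_iff_right]
  calc (1 : ENNReal) = μ Set.univ := by simp
    _ = μ (G ∪ Gᶜ) := by rw [Set.union_compl_self]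
    _ ≤ μ G + μ Gᶜ := measure_union_le _ _
    _ ≤ _ := by gcongr
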